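/- The inequality −3J + 2α₂ ≤ U_β(c,n₁,n₂,n₃) holds for all β ∈ {α₁, α₂} and all c, n₁, n₂, n₃ ∈ {0,1,2} if and only if J ≥ 0, α₂ ≤ 0 and α₁ ≥ α₂. (That is, the value U₂₇ = −3J + 2α₂ is the minimal possible unit-ball energy exactly on the set A₂₇ = {(J,α₁,α₂) : J ≥ 0, α₁ ≥ α₂, α₂ ≤ 0}.) -/

import Mathlib

/-- Unit-ball energy of the SOS model on the Cayley tree of order 2 with spin values
`{0,1,2}`, coupling `J`, where the center of the ball carries the external field
value `β`: for center spin `c` and neighbor spins `n₁, n₂, n₃`,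
`U_β(c,n₁,n₂,n₃) = -(J/2)·(|c−n₁| + |c−n₂| + |c−n₃|) + β·c`. -/
noncomputable def ballEnergy (J β : ℝ) (c n₁ n₂ n₃ : Fin 3) : ℝ :=
  -(J / 2) * (|((c : ℕ) : ℝ) - ((n₁ : ℕ) : ℝ)| + |((c : ℕ) : ℝ) - ((n₂ : ℕ) : ℝ)|
      + |((c : ℕ) : ℝ) - ((n₃ : ℕ) : ℝ)|)
    + β * ((c : ℕ) : ℝ)

/-- Two spin values differ by at most `2`. -/
theorem abs_spin_sub_le_two (a b : Fin 3) : |((a : ℕ) : ℝ) - ((b : ℕ) : ℝ)| ≤ 2 := by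
  fin_cases a <;> fin_cases b <;> norm_num [abs_le]

/-- For `J ≥ 0`, the energy is bounded below by `-3J` plus twice any nonpositive lower bound
of the field. -/
theorem neg_three_mul_add_le_ballEnergy {J α β : ℝ} (hJ : 0 ≤ J) (hα : α ≤ 0) (hβ : α ≤ β)
    (c n₁ n₂ n₃ : Fin 3) : -3 * J + 2 * α ≤ ballEnergy J β c n₁ n₂ n₃ := by
  have hc0 : (0 : ℝ) ≤ ((c : ℕ) : ℝ) := Nat.cast_nonneg _
  have hc2 : ((c : ℕ) : ℝ) ≤ 2 := by exact_mod_cast Nat.le_of_lt_succ c.isLt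
  have hfield : 2 * α ≤ β * ((c : ℕ) : ℝ) := by
    nlinarith [mul_nonneg (sub_nonneg.2 hβ) hc0, mul_nonneg (neg_nonneg.2 hα) (sub_nonneg.2 hc2)]
  have h₁ := mul_le_mul_of_nonneg_left (abs_spin_sub_le_two c n₁) hJ
  have h₂ := mul_le_mul_of_nonneg_left (abs_spin_sub_le_two c n₂) hJ
  have h₃ := mul_le_mul_of_nonneg_left (abs_spin_sub_le_two c n₃) hJ
  unfold ballEnergy
  linarith

/-- `U₂₇ = −3J + 2α₂` is the minimal unit-ball energy exactly when `J ≥ 0`,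
`α₂ ≤ 0` and `α₁ ≥ α₂`. -/
theorem neg_three_J_add_two_alpha_two_min_iff (J α₁ α₂ : ℝ) :
    (∀ β ∈ ({α₁, α₂} : Set ℝ), ∀ c n₁ n₂ n₃ : Fin 3,
        -3*J + 2*α₂ ≤ ballEnergy J β c n₁ n₂ n₃) ↔
      (0 ≤ J ∧ α₂ ≤ 0 ∧ α₂ ≤ α₁) := by
  constructor
  · intro h
    have hJ := h α₂ (by simp) 2 2 2 2
    have hα := h α₂ (by simp) 0 2 2 2
    have hβ := h α₁ (by simp) 2 0 0 0
    norm_num [ballEnergy] at hJ hα hβ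
    refine ⟨?_, ?_, ?_⟩ <;> linarith
  · rintro ⟨hJ, hα, hβ⟩ β hmem c n₁ n₂ n₃
    rcases hmem with rfl | rfl
    · exact neg_three_mul_add_le_ballEnergy hJ hα hβ c n₁ n₂ n₃
    · exact neg_three_mul_add_le_ballEnergy hJ hα le_rfl c n₁ n₂ n₃
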